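/- arXiv:math/0010210 — 6 statements merged into one kernel-verified Lean document; each statement's English description precedes it below -/
import Mathlib

section
/- Let ℓ be a prime and n a nonzero integer. Every continuous function f : ℤ_ℓ^× → ℚ_ℓ satisfying the cocycle identity f(στ) = f(σ) + σ^n·f(τ) for all σ, τ ∈ ℤ_ℓ^× is a coboundary: there exists a ∈ ℚ_ℓ such that f(σ) = (σ^n − 1)·a for all σ ∈ ℤ_ℓ^×. Equivalently, the continuous cohomology group H^1_cts(ℤ_ℓ^×, ℚ_ℓ(n)) vanishes for all nonzero integers n. -/
/-- For a prime `ℓ` and a nonzero integer `n`, every continuous 1-cocycle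
`f : ℤ_ℓˣ → ℚ_ℓ(n)` (i.e. `f (στ) = f σ + σ^n • f τ`) is a coboundary:
`H¹_cts(ℤ_ℓˣ, ℚ_ℓ(n)) = 0`. -/
theorem h1cts_units_padicInt_tate_twist_eq_zero
    (ℓ : ℕ) [Fact ℓ.Prime] (n : ℤ) (hn : n ≠ 0)
    (f : ℤ_[ℓ]ˣ → ℚ_[ℓ]) (hf : Continuous f)
    (hcoc : ∀ σ τ : ℤ_[ℓ]ˣ,
      f (σ * τ) = f σ + (((σ : ℤ_[ℓ]) : ℚ_[ℓ]) ^ n) * f τ) :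
    ∃ a : ℚ_[ℓ], ∀ σ : ℤ_[ℓ]ˣ,
      f σ = ((((σ : ℤ_[ℓ]) : ℚ_[ℓ]) ^ n) - 1) * a := by
  have hu : IsUnit ((1 + ℓ : ℕ) : ℤ_[ℓ]) := by
    rw [PadicInt.isUnit_iff]
    by_contra h
    have h1 : ‖((1 + ℓ : ℕ) : ℤ_[ℓ])‖ < 1 := lt_of_le_of_ne (PadicInt.norm_le_one _) h
    have h2 : ‖(((1 + ℓ : ℕ) : ℤ) : ℤ_[ℓ])‖ < 1 := by exact_mod_cast h1
    rw [PadicInt.norm_intCast_lt_one_iff] at h2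
    have h3 : ℓ ∣ 1 + ℓ := by exact_mod_cast h2
    have h4 : ℓ ∣ 1 := (Nat.dvd_add_left (dvd_refl ℓ)).mp h3
    exact (Fact.out : ℓ.Prime).one_lt.ne' (Nat.dvd_one.mp h4)
  obtain ⟨τ, hτ⟩ := hu
  have hne : (((τ : ℤ_[ℓ]) : ℚ_[ℓ]) ^ n) - 1 ≠ 0 := by
    rw [hτ, sub_ne_zero]
    intro h
    have h1 : ((1 + ℓ : ℕ) : ℚ) ^ n = 1 := by
      have : (((((1 + ℓ : ℕ) : ℚ) ^ n : ℚ)) : ℚ_[ℓ]) = ((1 : ℚ) : ℚ_[ℓ]) := by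
        push_cast at h ⊢
        exact h
      exact_mod_cast this
    have hl : (0 : ℚ) < ℓ := by exact_mod_cast (Fact.out : ℓ.Prime).pos
    have h2 : (1 : ℚ) < ((1 + ℓ : ℕ) : ℚ) := by
      push_cast
      linarith
    exact hn ((zpow_eq_one_iff_right₀ (by linarith) h2.ne').mp h1)
  refine ⟨f τ / ((((τ : ℤ_[ℓ]) : ℚ_[ℓ]) ^ n) - 1), fun σ => ?_⟩
  have h1 := hcoc σ τ
  rw [mul_comm, hcoc τ σ] at h1
  rw [← mul_div_assoc, eq_div_iff hne]
  linear_combination h1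
end

section
/- Let ℓ be a prime, n a nonzero integer, and Γ an open subgroup of ℤ_ℓ^×. Every continuous function f : Γ → ℚ_ℓ satisfying the cocycle identity f(στ) = f(σ) + σ^n·f(τ) for all σ, τ ∈ Γ is a coboundary: there exists a ∈ ℚ_ℓ such that f(σ) = (σ^n − 1)·a for all σ ∈ Γ. Equivalently, H^1_cts(Γ, ℚ_ℓ(n)) = 0 for every open subgroup Γ of ℤ_ℓ^× and every nonzero integer n. -/
/-- For a prime `ℓ`, a nonzero integer `n`, and an open subgroup `Γ` of `ℤ_ℓˣ`,
every continuous 1-cocycle `f : Γ → ℚ_ℓ(n)` is a coboundary: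
`H¹_cts(Γ, ℚ_ℓ(n)) = 0`. -/
theorem h1cts_openSubgroup_units_padicInt_tate_twist_eq_zero
    (ℓ : ℕ) [Fact ℓ.Prime] (n : ℤ) (hn : n ≠ 0)
    (Γ : Subgroup ℤ_[ℓ]ˣ) (hΓ : IsOpen (Γ : Set ℤ_[ℓ]ˣ))
    (f : Γ → ℚ_[ℓ]) (hf : Continuous f)
    (hcoc : ∀ σ τ : Γ,
      f (σ * τ) = f σ + ((((σ : ℤ_[ℓ]ˣ) : ℤ_[ℓ]) : ℚ_[ℓ]) ^ n) * f τ) :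
    ∃ a : ℚ_[ℓ], ∀ σ : Γ,
      f σ = (((((σ : ℤ_[ℓ]ˣ) : ℤ_[ℓ]) : ℚ_[ℓ]) ^ n) - 1) * a := by
  have hℓ : ℓ.Prime := Fact.out
  have key : ∃ τ : Γ, ((((τ : ℤ_[ℓ]ˣ) : ℤ_[ℓ]) : ℚ_[ℓ]) ^ n) ≠ 1 := by
    have hu : IsUnit (((1 + ℓ : ℕ) : ℤ_[ℓ])) := by
      rw [PadicInt.isUnit_iff, PadicInt.norm_natCast_eq_one_iff]
      simp
    obtain ⟨u, hu⟩ := hu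
    haveI : CompactSpace ℤ_[ℓ]ˣ := inferInstance
    have : Finite (ℤ_[ℓ]ˣ ⧸ Γ) := Subgroup.quotient_finite_of_isOpen Γ hΓ
    have hfi : Γ.FiniteIndex := Subgroup.finiteIndex_of_finite_quotient
    have hm : Γ.index ≠ 0 := hfi.index_ne_zero
    have hmem : u ^ Γ.index ∈ Γ := Γ.pow_index_mem u
    refine ⟨⟨_, hmem⟩, fun h => ?_⟩
    have h1 : (((1 + ℓ : ℕ) : ℚ_[ℓ]) ^ Γ.index) ^ n = 1 := by
      rw [← h]
      simp only [Units.val_pow_eq_pow_val, hu]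
      push_cast
      rfl
    have h2 : (((1 + ℓ : ℕ) : ℚ_[ℓ]) ^ Γ.index) ^ n.natAbs = 1 := by
      rcases Int.natAbs_eq n with h | h
      · rw [h, zpow_natCast] at h1; exact h1
      · rw [h, zpow_neg, zpow_natCast, inv_eq_one] at h1; exact h1
    rw [← pow_mul] at h2
    have h3 : (1 + ℓ) ^ (Γ.index * n.natAbs) = 1 := by exact_mod_cast h2
    rw [Nat.pow_eq_one] at h3
    rcases h3 with h3 | h3
    · have := hℓ.pos; omega
    · simp [hm, hn] at h3
  obtain ⟨τ, hτ⟩ := key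
  have hτ' := sub_ne_zero.mpr hτ
  refine ⟨f τ / ((((τ : ℤ_[ℓ]ˣ) : ℤ_[ℓ]) : ℚ_[ℓ]) ^ n - 1), fun σ => ?_⟩
  have e := hcoc σ τ
  rw [mul_comm, hcoc τ σ] at e
  rw [mul_div_assoc', eq_div_iff hτ']
  linear_combination e
end

section
/- Let V and V' be χ-weighted Γ-modules. Then every Γ-equivariant K-linear map f : V → V' automatically preserves the weight filtrations: f(W_m V) ⊆ W_m V' for every m ∈ ℤ. Consequently the χ-weighted Γ-modules (in particular, the ℓ-adic mixed Tate modules over the ring of S-integers) form a full subcategory of the category of Γ-modules, morphisms being required only to be Γ-equivariant linear maps. -/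
/-- `χ : Γ →* Kˣ` separates integer powers: for all integers `a ≠ b` there is
`σ ∈ Γ` with `χ(σ)^a ≠ χ(σ)^b`. -/
def SeparatesPowers {K Γ : Type*} [Field K] [Group Γ] (χ : Γ →* Kˣ) : Prop :=
  ∀ a b : ℤ, a ≠ b → ∃ σ : Γ, ((χ σ : K) ^ a) ≠ ((χ σ : K) ^ b)

/-- `W` is a weight filtration making the representation `ρ` of `Γ` on `V` a
`χ`-weighted `Γ`-module: `W` is an increasing filtration by `ρ`-invariant
subspaces with trivial intersection and exhaustive union, such that `Γ` acts on
the `m`-th graded quotient `W m / W (m-1)` through the character `χ^m`. -/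
def IsWeightFiltration {K Γ V : Type*} [Field K] [Group Γ]
    [AddCommGroup V] [Module K V]
    (χ : Γ →* Kˣ) (ρ : Representation K Γ V) (W : ℤ → Submodule K V) : Prop :=
  Monotone W ∧ (⨅ m, W m) = ⊥ ∧ (⨆ m, W m) = ⊤ ∧
    (∀ (m : ℤ) (σ : Γ), ∀ v ∈ W m, ρ σ v ∈ W m) ∧
    (∀ (m : ℤ) (σ : Γ), ∀ v ∈ W m, ρ σ v - ((χ σ : K) ^ m) • v ∈ W (m - 1))

/-- A `Γ`-equivariant linear map between `χ`-weighted `Γ`-modules automatically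
preserves the weight filtrations; hence weighted modules form a full
subcategory of the category of `Γ`-modules. -/
theorem equivariant_map_preserves_weight_filtration
    {K Γ V V' : Type*} [Field K] [Group Γ]
    [AddCommGroup V] [Module K V] [FiniteDimensional K V]
    [AddCommGroup V'] [Module K V'] [FiniteDimensional K V']
    (χ : Γ →* Kˣ) (hχ : SeparatesPowers χ)
    (ρ : Representation K Γ V) (W : ℤ → Submodule K V)
    (hW : IsWeightFiltration χ ρ W)
    (ρ' : Representation K Γ V') (W' : ℤ → Submodule K V')
    (hW' : IsWeightFiltration χ ρ' W')
    (f : V →ₗ[K] V') (hf : ∀ (σ : Γ) (v : V), f (ρ σ v) = ρ' σ (f v)) :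
    ∀ m : ℤ, ∀ v ∈ W m, f v ∈ W' m := by
  obtain ⟨hmono, hinf, -, -, hgr⟩ := hW
  obtain ⟨hmono', -, hsup', -, hgr'⟩ := hW'
  obtain ⟨n, hn⟩ := IsArtinian.monotone_stabilizes (R := K) (M := V)
    ⟨fun n : ℕ => OrderDual.toDual (W (-(n : ℤ))), fun a b hab => by
      change W (-(b : ℤ)) ≤ W (-(a : ℤ))
      exact hmono (by omega)⟩
  have hn' : ∀ k : ℕ, n ≤ k → W (-(n : ℤ)) = W (-(k : ℤ)) := fun k hk => hn k hk
  have hbot : W (-(n : ℤ)) = ⊥ := by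
    rw [eq_bot_iff, ← hinf]
    refine le_iInf fun m => ?_
    rw [hn' (max n m.natAbs) (le_max_left _ _)]
    exact hmono (by omega)
  have hex : ∀ w : V', ∃ k, w ∈ W' k := by
    intro w
    have : w ∈ ⨆ m, W' m := by rw [hsup']; trivial
    exact (Submodule.mem_iSup_of_directed _ hmono'.directed_le).1 this
  have step : ∀ m : ℤ, (∀ v ∈ W (m - 1), f v ∈ W' (m - 1)) → ∀ v ∈ W m, f v ∈ W' m := by
    intro m ih v hv
    have down : ∀ d : ℕ, f v ∈ W' (m + d) → f v ∈ W' m := by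
      intro d
      induction d with
      | zero => intro h; simpa using h
      | succ d ihd =>
        intro h
        apply ihd
        obtain ⟨σ, hσ⟩ := hχ m (m + (d + 1 : ℕ)) (by omega)
        have h1 := hmono' (show m - 1 ≤ m + d by omega) (ih _ (hgr m σ v hv))
        have h2 := hgr' _ σ _ h
        rw [show m + ((d + 1 : ℕ) : ℤ) - 1 = m + d by omega] at h2
        rw [map_sub, map_smul, hf] at h1
        have h3 := Submodule.sub_mem _ h2 h1
        rw [sub_sub_sub_cancel_left, ← sub_smul] at h3
        exact (Submodule.smul_mem_iff _ (sub_ne_zero.2 hσ)).1 h3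
    obtain ⟨k, hk⟩ := hex (f v)
    exact down (k - m).toNat (hmono' (by omega) hk)
  have up : ∀ d : ℕ, ∀ v ∈ W (-(n : ℤ) + d), f v ∈ W' (-(n : ℤ) + d) := by
    intro d
    induction d with
    | zero =>
      intro v hv
      have : v = 0 := by simpa [hbot] using hv
      simp [this]
    | succ d ih =>
      apply step
      rw [show -(n : ℤ) + ((d + 1 : ℕ) : ℤ) - 1 = -(n : ℤ) + d by omega]
      exact ih
  intro m v hv
  by_cases hm : -(n : ℤ) ≤ m
  · have := up (m + n).toNat
    rw [show -(n : ℤ) + ((m + n).toNat : ℤ) = m by omega] at this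
    exact this v hv
  · have h0 := hmono (show m ≤ -(n : ℤ) by omega) hv
    rw [hbot, Submodule.mem_bot] at h0
    simp [h0]
end

section
/- Let V and V' be χ-weighted Γ-modules and f : V → V' a Γ-equivariant K-linear map. Then f is strictly compatible with the weight filtrations: f(W_m V) = f(V) ∩ W_m V' for every m ∈ ℤ. -/
theorem wf_low {K V : Type*} [Field K] [AddCommGroup V] [Module K V] [FiniteDimensional K V]
    (W : ℤ → Submodule K V) (hm : Monotone W) (hb : (⨅ m, W m) = ⊥) :
    ∃ k : ℤ, ∀ j ≤ k, W j = ⊥ := by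
  obtain ⟨n, hn⟩ := IsArtinian.monotone_stabilizes (R := K) (M := V)
    ⟨fun i : ℕ => OrderDual.toDual (W (-(i : ℤ))), fun a b hab => by
      apply OrderDual.toDual_le_toDual.mpr
      exact hm (by omega)⟩
  have hn' : ∀ m : ℕ, n ≤ m → W (-(n : ℤ)) = W (-(m : ℤ)) := fun m h => hn m h
  have h0 : W (-(n : ℤ)) = ⊥ := by
    rw [eq_bot_iff, ← hb]
    refine le_iInf fun m => ?_
    rw [hn' (max n m.natAbs) (le_max_left _ _)]
    exact hm (by omega)
  refine ⟨-(n : ℤ), fun j hj => ?_⟩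
  rw [eq_bot_iff, ← h0]
  exact hm hj

theorem wf_high {K V : Type*} [Field K] [AddCommGroup V] [Module K V]
    (W : ℤ → Submodule K V) (hm : Monotone W) (hb : (⨆ m, W m) = ⊤) (v : V) :
    ∃ k : ℤ, v ∈ W k := by
  have : v ∈ ⨆ m, W m := by rw [hb]; trivial
  exact (Submodule.mem_iSup_of_directed W hm.directed_le).1 this

theorem wf_sep {K Γ V : Type*} [Field K] [Group Γ] [AddCommGroup V] [Module K V]
    {χ : Γ →* Kˣ} (hχ : SeparatesPowers χ) (ρ : Representation K Γ V)
    (N : Submodule K V) (x : V) {a b : ℤ} (hab : a ≠ b)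
    (ha : ∀ σ, ρ σ x - ((χ σ : K) ^ a) • x ∈ N)
    (hb : ∀ σ, ρ σ x - ((χ σ : K) ^ b) • x ∈ N) : x ∈ N := by
  obtain ⟨σ, hσ⟩ := hχ a b hab
  have h := N.sub_mem (hb σ) (ha σ)
  rw [sub_sub_sub_cancel_left, ← sub_smul] at h
  exact (N.smul_mem_iff (sub_ne_zero.2 hσ)).1 h

/-- A `Γ`-equivariant linear map between `χ`-weighted `Γ`-modules is strictly
compatible with the weight filtrations: `f(W_m V) = f(V) ⊓ W_m V'`. -/
theorem equivariant_map_strict_with_weight_filtration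
    {K Γ V V' : Type*} [Field K] [Group Γ]
    [AddCommGroup V] [Module K V] [FiniteDimensional K V]
    [AddCommGroup V'] [Module K V'] [FiniteDimensional K V']
    (χ : Γ →* Kˣ) (hχ : SeparatesPowers χ)
    (ρ : Representation K Γ V) (W : ℤ → Submodule K V)
    (hW : IsWeightFiltration χ ρ W)
    (ρ' : Representation K Γ V') (W' : ℤ → Submodule K V')
    (hW' : IsWeightFiltration χ ρ' W')
    (f : V →ₗ[K] V') (hf : ∀ (σ : Γ) (v : V), f (ρ σ v) = ρ' σ (f v)) :
    ∀ m : ℤ, Submodule.map f (W m) = LinearMap.range f ⊓ W' m := by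
  obtain ⟨hm, hbot, htop, hinv, hgr⟩ := hW
  obtain ⟨hm', hbot', htop', hinv', hgr'⟩ := hW'
  obtain ⟨k0, hk0⟩ := wf_low W hm hbot
  obtain ⟨k1, hk1⟩ := wf_low W' hm' hbot'
  -- compatibility
  have compat : ∀ n : ℤ, ∀ v ∈ W n, f v ∈ W' n := by
    have key : ∀ (d : ℕ) (n : ℤ), n ≤ k0 + d → ∀ v ∈ W n, f v ∈ W' n := by
      intro d
      induction d with
      | zero =>
        intro n hn v hv
        rw [hk0 n (by simpa using hn)] at hv
        rw [(Submodule.mem_bot K).1 hv, map_zero]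
        exact zero_mem _
      | succ d ih =>
        intro n hn v hv
        obtain ⟨k, hk⟩ := wf_high W' hm' htop' (f v)
        have down : ∀ e : ℕ, f v ∈ W' (n + e) → f v ∈ W' n := by
          intro e
          induction e with
          | zero => intro h; simpa using h
          | succ e ihe =>
            intro h
            apply ihe
            have e1 : n + ((e + 1 : ℕ) : ℤ) - 1 = n + e := by push_cast; ring
            refine wf_sep hχ ρ' _ _ (a := n) (b := n + ((e + 1 : ℕ) : ℤ)) (by omega) ?_ ?_
            · intro σ
              rw [← hf, ← map_smul, ← map_sub]
              exact hm' (by omega) (ih (n - 1) (by push_cast at hn; omega) _ (hgr n σ v hv))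
            · intro σ
              have := hgr' _ σ _ h
              rwa [e1] at this
        exact down (k - n).toNat (hm' (by omega) hk)
    intro n
    exact key (n - k0).toNat n (by omega)
  -- one step of lowering
  have step : ∀ m n : ℤ, m < n → ∀ v ∈ W n, f v ∈ W' m → ∃ w ∈ W (n - 1), f w = f v := by
    intro m n hmn
    have key : ∀ (d : ℕ) (k : ℤ), k ≤ k1 + d → k ≤ m → ∀ v ∈ W n, f v ∈ W' k →
        f v ∈ (W (n - 1)).map f := by
      intro d
      induction d with
      | zero =>
        intro k hk _ v _ hfv
        rw [hk1 k (by simpa using hk)] at hfv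
        rw [(Submodule.mem_bot K).1 hfv]
        exact zero_mem _
      | succ d ih =>
        intro k hk hkm v hv hfv
        refine wf_sep hχ ρ' _ _ (a := k) (b := n) (by omega) ?_ ?_
        · intro σ
          have h := hgr' k σ _ hfv
          rw [← hf, ← map_smul, ← map_sub] at h ⊢
          exact ih (k - 1) (by push_cast at hk; omega) (by omega) _
            ((W n).sub_mem (hinv n σ v hv) ((W n).smul_mem _ hv)) h
        · intro σ
          rw [← hf, ← map_smul, ← map_sub]
          exact Submodule.mem_map_of_mem (hgr n σ v hv)
    intro v hv hfv
    exact key (m - k1).toNat m (by omega) le_rfl v hv hfv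
  intro m
  apply le_antisymm
  · rintro _ ⟨v, hv, rfl⟩
    exact ⟨⟨v, rfl⟩, compat m v hv⟩
  · rintro _ ⟨⟨v, rfl⟩, hfv⟩
    have down : ∀ (e : ℕ) (v : V), v ∈ W (m + e) → f v ∈ W' m → f v ∈ (W m).map f := by
      intro e
      induction e with
      | zero => intro v hv _; exact Submodule.mem_map_of_mem (by simpa using hv)
      | succ e ih =>
        intro v hv hfv
        obtain ⟨w, hw, hwv⟩ := step m _ (by omega) v hv hfv
        have e1 : m + ((e + 1 : ℕ) : ℤ) - 1 = m + e := by push_cast; ring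
        rw [e1] at hw
        rw [← hwv] at hfv ⊢
        exact ih w hw hfv
    obtain ⟨k, hk⟩ := wf_high W hm htop v
    exact down (k - m).toNat v (hm (by omega) hk) hfv
end

section
/- The weight filtration of a χ-weighted Γ-module is unique: if W• and W̃• are two filtrations of the same finite-dimensional representation (V, ρ) of Γ, each satisfying the axioms of a χ-weighted Γ-module (increasing, ρ-invariant, with trivial intersection and exhaustive union, and with Γ acting on the m-th graded quotient through χ^m), then W_m V = W̃_m V for every m ∈ ℤ. -/
theorem wf_exists_top {K V : Type*} [Field K] [AddCommGroup V] [Module K V]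
    [FiniteDimensional K V] (W : ℤ → Submodule K V) (hm : Monotone W)
    (h : (⨆ m, W m) = ⊤) : ∃ N : ℤ, W N = ⊤ := by
  obtain ⟨n, hn⟩ := WellFoundedGT.monotone_chain_condition
    (⟨fun k : ℕ => W k, fun a b hab => hm (by exact_mod_cast hab)⟩ : ℕ →o Submodule K V)
  refine ⟨n, top_le_iff.mp ?_⟩
  rw [← h]
  refine iSup_le fun m => ?_
  have h1 : W (n : ℤ) = W ((max n m.toNat : ℕ) : ℤ) := hn (max n m.toNat) (le_max_left _ _)
  rw [h1]
  exact hm (by omega)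

theorem wf_exists_bot {K V : Type*} [Field K] [AddCommGroup V] [Module K V]
    [FiniteDimensional K V] (W : ℤ → Submodule K V) (hm : Monotone W)
    (h : (⨅ m, W m) = ⊥) : ∃ N : ℤ, W N = ⊥ := by
  obtain ⟨n, hn⟩ := IsArtinian.monotone_stabilizes
    (⟨fun k : ℕ => OrderDual.toDual (W (-(k : ℤ))),
      fun a b hab => OrderDual.toDual_le_toDual.mpr (hm (by omega))⟩ : ℕ →o (Submodule K V)ᵒᵈ)
  refine ⟨-(n : ℤ), le_bot_iff.mp ?_⟩
  rw [← h]
  refine le_iInf fun m => ?_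
  have h1 : W (-(n : ℤ)) = W (-((max n (-m).toNat : ℕ) : ℤ)) :=
    hn (max n (-m).toNat) (le_max_left _ _)
  rw [h1]
  exact hm (by omega)

theorem wf_le {K Γ V : Type*} [Field K] [Group Γ]
    [AddCommGroup V] [Module K V] [FiniteDimensional K V]
    (χ : Γ →* Kˣ) (hχ : SeparatesPowers χ)
    (ρ : Representation K Γ V) (W W' : ℤ → Submodule K V)
    (hW : IsWeightFiltration χ ρ W)
    (hW' : IsWeightFiltration χ ρ W') (m : ℤ) : W m ≤ W' m := by
  obtain ⟨hm, hb, -, -, hg⟩ := hW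
  obtain ⟨hm', -, ht', -, hg'⟩ := hW'
  obtain ⟨B, hB⟩ := wf_exists_bot W hm hb
  obtain ⟨T, hT⟩ := wf_exists_top W' hm' ht'
  have key : ∀ m, W (m - 1) ≤ W' (m - 1) → W m ≤ W' m := by
    intro m ih
    have down : ∀ k : ℕ, W m ≤ W' (max m (T - k)) := by
      intro k
      induction k with
      | zero =>
        have : W' (max m (T - (0 : ℕ))) = ⊤ := top_le_iff.mp (hT ▸ hm' (by omega))
        rw [this]; exact le_top
      | succ k ihk =>
        by_cases hk : T - (k : ℤ) ≤ m
        · exact ihk.trans (hm' (by omega))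
        · have e : max m (T - (k : ℤ)) = T - k := by omega
          rw [e] at ihk
          refine le_trans ?_ (hm' (show T - (k : ℤ) - 1 ≤ _ by push_cast; omega))
          intro v hv
          obtain ⟨σ, hσ⟩ := hχ (T - k) m (by omega)
          have h1 := hm' (show m - 1 ≤ T - (k : ℤ) - 1 by omega) (ih (hg m σ v hv))
          have h2 := hg' _ σ v (ihk hv)
          have h3 := Submodule.sub_mem _ h1 h2
          rw [sub_sub_sub_cancel_left, ← sub_smul] at h3
          exact (Submodule.smul_mem_iff _ (sub_ne_zero.mpr hσ)).mp h3
    have := down (T - m).toNat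
    exact this.trans (hm' (by omega))
  have up : ∀ k : ℕ, W (B + k) ≤ W' (B + k) := by
    intro k
    induction k with
    | zero => simp [hB]
    | succ k ih =>
      apply key
      have e : B + ((k + 1 : ℕ) : ℤ) - 1 = B + k := by push_cast; ring
      rw [e]; exact ih
  by_cases h : m ≤ B
  · have := hm h
    rw [hB] at this
    exact this.trans bot_le
  · have := up (m - B).toNat
    have e : B + ((m - B).toNat : ℤ) = m := by omega
    rwa [e] at this

/-- The weight filtration of a `χ`-weighted `Γ`-module is unique. -/
theorem weight_filtration_unique
    {K Γ V : Type*} [Field K] [Group Γ]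
    [AddCommGroup V] [Module K V] [FiniteDimensional K V]
    (χ : Γ →* Kˣ) (hχ : SeparatesPowers χ)
    (ρ : Representation K Γ V) (W W' : ℤ → Submodule K V)
    (hW : IsWeightFiltration χ ρ W)
    (hW' : IsWeightFiltration χ ρ W') :
    ∀ m : ℤ, W m = W' m := by
  exact fun m => le_antisymm (wf_le χ hχ ρ W W' hW hW' m) (wf_le χ hχ ρ W' W hW' hW m)
end

section
/- Let V and V' be χ-weighted Γ-modules and f : V → V' a Γ-equivariant K-linear map. Then for every m ∈ ℤ one has the equality of subspaces W_m V ∩ f^{-1}(W_{m−1} V') = (ker f ∩ W_m V) + W_{m−1} V. Equivalently, the kernel of the induced map Gr^W_m f : Gr^W_m V → Gr^W_m V' equals the image of ker f ∩ W_m V in Gr^W_m V; together with strict compatibility this expresses that the associated graded functor Gr^W_• is exact on χ-weighted Γ-modules. -/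
open Polynomial in
theorem aux_graded {K Γ V : Type*} [Field K] [Group Γ] [AddCommGroup V] [Module K V]
    {χ : Γ →* Kˣ} {ρ : Representation K Γ V} {W : ℤ → Submodule K V}
    (hW : IsWeightFiltration χ ρ W) (σ : Γ) (k : ℤ) (p : K[X]) :
    ∀ v ∈ W k, aeval (ρ σ) p v - p.eval ((χ σ : K) ^ k) • v ∈ W (k - 1) := by
  obtain ⟨hm, -, -, hinv, hgr⟩ := hW
  induction p using Polynomial.induction_on with
  | C a => intro v hv; simp [Module.algebraMap_end_apply]
  | add p q hp hq =>
    intro v hv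
    have := (W (k-1)).add_mem (hp v hv) (hq v hv)
    simp only [map_add, LinearMap.add_apply, eval_add, add_smul]
    convert this using 1
    abel
  | monomial n a ih =>
    intro v hv
    have h1 := ih _ (hinv k σ v hv)
    have h2 := (W (k-1)).smul_mem (eval ((χ σ : K) ^ k) (C a * X ^ n)) (hgr k σ v hv)
    have := (W (k-1)).add_mem h1 h2
    rw [pow_succ, ← mul_assoc, map_mul, aeval_X, Module.End.mul_apply, eval_mul, eval_X]
    convert this using 1
    rw [smul_sub, smul_smul]
    abel

open Polynomial in
/-- The product of the first `n` linear factors above weight `lo`. -/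
noncomputable def auxP {K : Type*} [Field K] (c : K) (lo : ℤ) (n : ℕ) : K[X] :=
  ∏ i ∈ Finset.range n, (X - C (c ^ (lo + 1 + (i : ℤ))))

open Polynomial in
theorem aux_kill {K Γ V : Type*} [Field K] [Group Γ] [AddCommGroup V] [Module K V]
    {χ : Γ →* Kˣ} {ρ : Representation K Γ V} {W : ℤ → Submodule K V}
    (hW : IsWeightFiltration χ ρ W) (σ : Γ) (lo : ℤ) (hlo : W lo = ⊥) (n : ℕ) :
    ∀ v ∈ W (lo + n), aeval (ρ σ) (auxP (χ σ : K) lo n) v = 0 := by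
  obtain ⟨hm, -, -, hinv, hgr⟩ := hW
  induction n with
  | zero => intro v hv; simp [hlo] at hv; simp [hv]
  | succ n ih =>
    intro v hv
    have h := hgr _ σ v hv
    have e : lo + ((n + 1 : ℕ) : ℤ) - 1 = lo + n := by push_cast; ring
    rw [e] at h
    have h3 := ih _ h
    have e2 : lo + ((n + 1 : ℕ) : ℤ) = lo + 1 + n := by push_cast; ring
    rw [e2] at h3
    rw [auxP, Finset.prod_range_succ, map_mul, Module.End.mul_apply]
    simpa [Module.algebraMap_end_apply, auxP] using h3

open Polynomial in
theorem aux_ne {K : Type*} [Field K] (c : K) (hc0 : c ≠ 0) (N : ℕ)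
    (hc : c ^ (N.factorial) ≠ 1) (lo k : ℤ) (n : ℕ) (h1 : lo + n < k) (h2 : k ≤ lo + N) :
    (auxP c lo n).eval (c ^ k) ≠ 0 := by
  rw [auxP, eval_prod, Finset.prod_ne_zero_iff]
  intro i hi
  rw [Finset.mem_range] at hi
  simp only [eval_sub, eval_X, eval_C]
  rw [sub_ne_zero]
  intro h
  obtain ⟨d, hd⟩ : ∃ d : ℕ, k = lo + 1 + i + d := ⟨(k - (lo+1+i)).toNat, by omega⟩
  apply hc
  rw [hd, zpow_add₀ hc0] at h
  have h' : c ^ d = 1 := by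
    have := mul_left_cancel₀ (b := c ^ (d:ℤ)) (c := 1) (zpow_ne_zero (lo+1+i) hc0) (by rw [h, mul_one])
    simpa using this
  obtain ⟨e, he⟩ : d ∣ N.factorial := Nat.dvd_factorial (by omega) (by omega)
  rw [he, pow_mul, h', one_pow]

theorem aux_lo {K V : Type*} [Field K] [AddCommGroup V] [Module K V] [FiniteDimensional K V]
    (W : ℤ → Submodule K V) (hm : Monotone W) (h : (⨅ m, W m) = ⊥) :
    ∃ a, ∀ b ≤ a, W b = ⊥ := by
  obtain ⟨n, hn⟩ := IsArtinian.monotone_stabilizes (R := K) (M := V)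
    ⟨fun n : ℕ => OrderDual.toDual (W (-(n:ℤ))), fun a b hab => by
      apply OrderDual.toDual_le_toDual.2; exact hm (by omega)⟩
  have hn' : ∀ m : ℕ, n ≤ m → W (-(n:ℤ)) = W (-(m:ℤ)) := fun m hm => hn m hm
  refine ⟨-(n:ℤ), fun b hb => ?_⟩
  rw [eq_bot_iff, ← h]
  refine le_iInf fun j => ?_
  refine (hm hb).trans ?_
  rw [hn' (max n (-j).toNat) (le_max_left _ _)]
  exact hm (by omega)

theorem aux_hi {K V : Type*} [Field K] [AddCommGroup V] [Module K V] [FiniteDimensional K V]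
    (W : ℤ → Submodule K V) (hm : Monotone W) (h : (⨆ m, W m) = ⊤) :
    ∃ a, ∀ b ≥ a, W b = ⊤ := by
  obtain ⟨n, hn⟩ := monotone_stabilizes_iff_noetherian.2 (inferInstance : IsNoetherian K V)
    ⟨fun n : ℕ => W (n:ℤ), fun a b hab => hm (by omega)⟩
  have hn' : ∀ m : ℕ, n ≤ m → W (n:ℤ) = W (m:ℤ) := fun m hm => hn m hm
  refine ⟨(n:ℤ), fun b hb => ?_⟩
  rw [eq_top_iff, ← h]
  refine iSup_le fun j => ?_
  refine le_trans ?_ (hm hb)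
  rw [hn' (max n j.toNat) (le_max_left _ _)]
  exact hm (by omega)

/-- For a `Γ`-equivariant linear map `f` between `χ`-weighted `Γ`-modules one
has `W_m V ⊓ f⁻¹(W_{m-1} V') = (ker f ⊓ W_m V) + W_{m-1} V`, i.e. the kernel
of `Gr^W_m f` is the image of `ker f ⊓ W_m V`; together with strictness this
expresses the exactness of the functor `Gr^W`. -/
theorem ker_graded_map_eq
    {K Γ V V' : Type*} [Field K] [Group Γ]
    [AddCommGroup V] [Module K V] [FiniteDimensional K V]
    [AddCommGroup V'] [Module K V'] [FiniteDimensional K V']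
    (χ : Γ →* Kˣ) (hχ : SeparatesPowers χ)
    (ρ : Representation K Γ V) (W : ℤ → Submodule K V)
    (hW : IsWeightFiltration χ ρ W)
    (ρ' : Representation K Γ V') (W' : ℤ → Submodule K V')
    (hW' : IsWeightFiltration χ ρ' W')
    (f : V →ₗ[K] V') (hf : ∀ (σ : Γ) (v : V), f (ρ σ v) = ρ' σ (f v)) :
    ∀ m : ℤ, W m ⊓ Submodule.comap f (W' (m - 1)) =
      (LinearMap.ker f ⊓ W m) ⊔ W (m - 1) := by
  intro m
  obtain ⟨a, ha⟩ := aux_lo W hW.1 hW.2.1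
  obtain ⟨a', ha'⟩ := aux_lo W' hW'.1 hW'.2.1
  obtain ⟨b', hb'⟩ := aux_hi W' hW'.1 hW'.2.2.1
  obtain ⟨lo, h1, h2, h3⟩ : ∃ lo : ℤ, lo ≤ a ∧ lo ≤ a' ∧ lo ≤ m - 1 :=
    ⟨min a (min a' (m-1)), by omega, by omega, by omega⟩
  obtain ⟨N, h4, h5⟩ : ∃ N : ℕ, b' ≤ lo + N ∧ m ≤ lo + N :=
    ⟨(max b' m - lo).toNat, by omega, by omega⟩
  obtain ⟨n, hn⟩ : ∃ n : ℕ, m - 1 = lo + n := ⟨(m - 1 - lo).toNat, by omega⟩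
  obtain ⟨σ, hσ⟩ := hχ (N.factorial : ℤ) 0 (by exact_mod_cast N.factorial_ne_zero)
  have hc : (χ σ : K) ^ N.factorial ≠ 1 := by simpa only [zpow_natCast, zpow_zero] using hσ
  have hc0 : (χ σ : K) ≠ 0 := (χ σ).ne_zero
  have hcomm : ∀ (p : Polynomial K) (v : V),
      f (Polynomial.aeval (ρ σ) p v) = Polynomial.aeval (ρ' σ) p (f v) := by
    intro p
    induction p using Polynomial.induction_on with
    | C a => intro v; simp [Module.algebraMap_end_apply]
    | add p q hp hq => intro v; simp [hp, hq]
    | monomial n a ih =>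
      intro v
      rw [pow_succ, ← mul_assoc, map_mul, Polynomial.aeval_X, Module.End.mul_apply, ih, hf,
        map_mul (Polynomial.aeval (ρ' σ)) _ Polynomial.X, Polynomial.aeval_X, Module.End.mul_apply]
  set P := auxP (χ σ : K) lo n with hP
  have hk := aux_kill hW σ lo (ha _ h1) n
  have hk' := aux_kill hW' σ lo (ha' _ h2) n
  rw [← hn] at hk hk'
  apply le_antisymm
  · rintro v ⟨hv, hfv⟩
    have hg := aux_graded hW σ m P v hv
    have hne : P.eval ((χ σ : K) ^ m) ≠ 0 := aux_ne _ hc0 N hc lo m n (by omega) h5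
    have hPv : Polynomial.aeval (ρ σ) P v ∈ LinearMap.ker f ⊓ W m := by
      refine ⟨?_, ?_⟩
      · rw [SetLike.mem_coe, LinearMap.mem_ker, hcomm]
        exact hk' _ hfv
      · have := (W m).add_mem (hW.1 (by omega : m - 1 ≤ m) hg)
          ((W m).smul_mem (P.eval ((χ σ : K) ^ m)) hv)
        simpa using this
    have h6 := Submodule.sub_mem _ (Submodule.mem_sup_left (T := W (m-1)) hPv)
      (Submodule.mem_sup_right (S := LinearMap.ker f ⊓ W m) hg)
    rw [sub_sub_cancel] at h6
    exact (Submodule.smul_mem_iff _ hne).1 h6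
  · refine sup_le (le_inf inf_le_right ?_) (le_inf (hW.1 (by omega)) ?_)
    · rintro v ⟨hv, -⟩
      have hv' : f v = 0 := hv
      simp [hv']
    · intro v hv
      have h0 : Polynomial.aeval (ρ' σ) P (f v) = 0 := by rw [← hcomm, hk v hv, map_zero]
      have key : ∀ d : ℕ, n + d ≤ N → f v ∈ W' (lo + (n + d : ℕ)) → f v ∈ W' (m - 1) := by
        intro d
        induction d with
        | zero => intro _ h; rw [hn]; simpa using h
        | succ d ih =>
          intro hd h
          refine ih (by omega) ?_
          have hg := aux_graded hW' σ _ P _ h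
          rw [h0, zero_sub, neg_mem_iff] at hg
          have := (Submodule.smul_mem_iff _
            (aux_ne _ hc0 N hc lo _ n (by omega) (by omega))).1 hg
          convert this using 2
          push_cast
          ring
      refine key (N - n) (by omega) ?_
      rw [hb' _ (by omega)]
      trivial
end
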